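/- For every constant C > 10 there exist an absolute constant c > 0 and an integer n₀ such that for all n ≥ n₀ the following holds. Let s = ⌈√(C·n)⌉ and δ = 1/C, and define distributions q₁,…,q_s over [n] by q_i(1) = 1 − δ/20 − s/n, q_i(i+1) = δ/20, and q_i(x) = 1/n for x ∈ {2,…,s+1}∖{i+1} (and q_i(x) = 0 for x > s+1). Then: (a) ‖q_i − U_n‖₁ ≥ 1/3 for every i; (b) q₁,…,q_s satisfy the structural condition with respect to the uniform distribution U_n; and (c) letting Y₁,…,Y_s be independent with Y_i ~ q_i, letting σ be a uniformly random permutation of {1,…,s} independent of the Y_i's, and letting P be the distribution on [n]^s of the exchangeable sequence (Y_{σ(1)},…,Y_{σ(s)}), for every countable collection of distributions (p_k) over [n] and nonnegative weights (w_k) with Σ_k w_k = 1, the mixture M = Σ_k w_k·p_k^{⊗s} satisfies ‖P − M‖₁ ≥ c. -/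

import Mathlib

open Finset

/-- A distribution over `[n]`: a nonnegative function summing to `1`. -/
def IsDist {n : ℕ} (p : Fin n → ℝ) : Prop :=
  (∀ x, 0 ≤ p x) ∧ ∑ x, p x = 1

section ProductSums

variable {ι α : Type*} [Fintype ι] [DecidableEq ι] [Fintype α]

/-- The expectation of a function of a single coordinate under a product weight. -/
lemma sum_coord_mul_prod (q : ι → α → ℝ) (h : α → ℝ) (i₀ : ι) :
    ∑ y : ι → α, h (y i₀) * ∏ i, q i (y i)
      = (∑ x, h x * q i₀ x) * ∏ i ∈ univ.erase i₀, ∑ x, q i x := by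
  have key : ∀ y : ι → α, h (y i₀) * ∏ i, q i (y i)
      = ∏ i, ((if i = i₀ then h (y i) else 1) * q i (y i)) := by
    intro y
    rw [Finset.prod_mul_distrib, Finset.prod_ite_eq' univ i₀ (fun i => h (y i))]
    simp
  simp_rw [key]
  rw [← Fintype.prod_sum (fun i x => (if i = i₀ then h x else 1) * q i x),
    ← Finset.mul_prod_erase univ _ (Finset.mem_univ i₀)]
  congr 1
  · simp
  · refine Finset.prod_congr rfl fun i hi => ?_
    simp [(Finset.mem_erase.mp hi).1]

/-- The expectation of a product of functions of disjoint pairs of coordinates under a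
product weight factorizes over the pairs. -/
lemma sum_pairs_mul_prod {J K : Type*} [Fintype J] [DecidableEq J] [Fintype K] [DecidableEq K]
    (e : (J ⊕ J) ⊕ K ≃ ι) (q : ι → α → ℝ) (f : α → α → ℝ) :
    ∑ y : ι → α, (∏ j, f (y (e (.inl (.inl j)))) (y (e (.inl (.inr j))))) * ∏ i, q i (y i)
      = (∏ j, ∑ a, ∑ b, f a b * (q (e (.inl (.inl j))) a * q (e (.inl (.inr j))) b))
        * ∏ k, ∑ a, q (e (.inr k)) a := by
  have step : ∀ y : ι → α,
      (∏ j, f (y (e (.inl (.inl j)))) (y (e (.inl (.inr j))))) * ∏ i, q i (y i)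
      = (∏ j, f (y (e (.inl (.inl j)))) (y (e (.inl (.inr j)))) *
          (q (e (.inl (.inl j))) (y (e (.inl (.inl j)))) *
            q (e (.inl (.inr j))) (y (e (.inl (.inr j))))))
        * ∏ k, q (e (.inr k)) (y (e (.inr k))) := by
    intro y
    rw [← Equiv.prod_comp e (fun i => q i (y i)), Fintype.prod_sum_type, Fintype.prod_sum_type]
    simp only [Finset.prod_mul_distrib]
    ring
  simp_rw [step]
  rw [← Equiv.sum_comp (Equiv.arrowCongr e (Equiv.refl α))]
  simp only [Equiv.arrowCongr_apply, Function.comp_apply, Equiv.symm_apply_apply,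
    Equiv.coe_refl, id_eq]
  rw [← Equiv.sum_comp (Equiv.sumArrowEquivProdArrow (J ⊕ J) K α).symm, Fintype.sum_prod_type]
  simp only [Equiv.sumArrowEquivProdArrow_symm_apply_inl,
    Equiv.sumArrowEquivProdArrow_symm_apply_inr]
  simp_rw [← Finset.mul_sum]
  rw [← Finset.sum_mul, ← Fintype.prod_sum (fun k a => q (e (.inr k)) a),
    ← Equiv.sum_comp (Equiv.sumArrowEquivProdArrow J J α).symm, Fintype.sum_prod_type]
  simp only [Equiv.sumArrowEquivProdArrow_symm_apply_inl,
    Equiv.sumArrowEquivProdArrow_symm_apply_inr]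
  congr 1
  rw [Fintype.prod_sum (fun j a =>
    ∑ b, f a b * (q (e (.inl (.inl j))) a * q (e (.inl (.inr j))) b))]
  refine Finset.sum_congr rfl fun u _ => ?_
  rw [Fintype.prod_sum (fun j b =>
    f (u j) b * (q (e (.inl (.inl j))) (u j) * q (e (.inl (.inr j))) b))]

end ProductSums

section Collision

variable {α : Type*} [DecidableEq α]

/-- The indicator that `a` and `b` do not coincide at an element of `B`. -/
def noCollision (B : Finset α) (a b : α) : ℝ := if a = b ∧ a ∈ B then 0 else 1

lemma noCollision_nonneg (B : Finset α) (a b : α) : 0 ≤ noCollision B a b := by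
  unfold noCollision; split_ifs <;> norm_num

lemma noCollision_le_one (B : Finset α) (a b : α) : noCollision B a b ≤ 1 := by
  unfold noCollision; split_ifs <;> norm_num

lemma sum_noCollision [Fintype α] (B : Finset α) (p q : α → ℝ) :
    ∑ a, ∑ b, noCollision B a b * (p a * q b)
      = (∑ a, p a) * (∑ b, q b) - ∑ a ∈ B, p a * q a := by
  have h : ∀ a b, noCollision B a b * (p a * q b)
      = p a * q b - if a = b then (if a ∈ B then p a * q b else 0) else 0 := by
    intro a b
    unfold noCollision
    by_cases h1 : a = b <;> by_cases h2 : a ∈ B <;> simp_all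
  simp_rw [h, Finset.sum_sub_distrib, Finset.sum_mul_sum]
  simp

end Collision

/-- The probability that none of `t` independent pairs of samples from `p` collides in `B`. -/
lemma pow_noCollision_le {α : Type*} [Fintype α] {p : α → ℝ} (hp : ∀ x, 0 ≤ p x) (hp1 : ∑ x, p x = 1)
    (B : Finset α) {t : ℕ} (ht : #B ≤ 4 * t) :
    (1 - ∑ a ∈ B, p a * p a) ^ t ≤ 1 - (∑ a ∈ B, p a) ^ 2 / 8 := by
  set m := ∑ a ∈ B, p a with hm
  set κ := ∑ a ∈ B, p a * p a with hκ
  have hm0 : 0 ≤ m := Finset.sum_nonneg fun x _ => hp x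
  have hm1 : m ≤ 1 := hp1 ▸ Finset.sum_le_univ_sum_of_nonneg hp
  have hcs : m ^ 2 ≤ #B * κ := by
    have := sq_sum_le_card_mul_sum_sq (s := B) (f := p)
    simpa [hm, hκ, sq] using this
  have hκ0 : 0 ≤ κ := Finset.sum_nonneg fun x _ => mul_self_nonneg _
  have hκ1 : κ ≤ 1 := by
    refine le_trans (Finset.sum_le_sum fun x _ => ?_) hm1
    have : p x ≤ 1 := hp1 ▸ Finset.single_le_sum (fun y _ => hp y) (Finset.mem_univ x)
    nlinarith [hp x]
  have htB : (#B : ℝ) ≤ 4 * t := by exact_mod_cast ht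
  have hx : m ^ 2 / 4 ≤ t * κ := by nlinarith
  calc (1 - κ) ^ t ≤ Real.exp (-κ) ^ t := by
        refine pow_le_pow_left₀ (by linarith) ?_ t
        linarith [Real.add_one_le_exp (-κ)]
    _ = Real.exp (-(t * κ)) := by rw [← Real.exp_nat_mul]; ring_nf
    _ ≤ Real.exp (-(m ^ 2 / 4)) := Real.exp_le_exp.mpr (by linarith)
    _ ≤ 1 - m ^ 2 / 8 := by
        rw [Real.exp_neg]
        have h1 := Real.add_one_le_exp (m ^ 2 / 4)
        have h2 : m ^ 2 ≤ 1 := by nlinarith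
        rw [inv_le_comm₀ (Real.exp_pos _) (by linarith)]
        refine le_trans ?_ h1
        rw [inv_le_iff_one_le_mul₀ (by linarith)]
        nlinarith [sq_nonneg m]

section Mixtures

variable {β : Type*} [Fintype β]

/-- A test with values in `[0,1]` lower-bounds the `ℓ₁`-distance. -/
lemma abs_sum_mul_sub_le (P M g : β → ℝ) (h0 : ∀ y, 0 ≤ g y) (h1 : ∀ y, g y ≤ 1) :
    |∑ y, g y * P y - ∑ y, g y * M y| ≤ ∑ y, |P y - M y| := by
  rw [← Finset.sum_sub_distrib]
  refine (Finset.abs_sum_le_sum_abs _ _).trans (Finset.sum_le_sum fun y _ => ?_)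
  rw [← mul_sub, abs_mul, abs_of_nonneg (h0 y)]
  exact mul_le_of_le_one_left (abs_nonneg _) (h1 y)

lemma sum_mul_tsum_mixture (w : ℕ → ℝ) (hw : ∀ k, 0 ≤ w k) (hs : Summable w) (g : β → ℝ)
    (R : ℕ → β → ℝ) (hR0 : ∀ k y, 0 ≤ R k y) (hR1 : ∀ k y, R k y ≤ 1) :
    ∑ y, g y * ∑' k, w k * R k y = ∑' k, w k * ∑ y, g y * R k y := by
  have hsum : ∀ y, Summable fun k => w k * R k y := fun y =>
    Summable.of_nonneg_of_le (fun k => mul_nonneg (hw k) (hR0 k y))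
      (fun k => mul_le_of_le_one_right (hw k) (hR1 k y)) hs
  simp_rw [← tsum_mul_left]
  rw [← Summable.tsum_finsetSum fun y _ => (hsum y).mul_left (g y)]
  refine tsum_congr fun k => ?_
  rw [Finset.mul_sum]
  exact Finset.sum_congr rfl fun y _ => by ring

/-- A form of Jensen's inequality for countable mixtures. -/
lemma tsum_mul_le_one_sub_sq (w a b : ℕ → ℝ) (hw : ∀ k, 0 ≤ w k) (hw1 : ∑' k, w k = 1)
    (hs : Summable w) (ha0 : ∀ k, 0 ≤ a k) (ha1 : ∀ k, a k ≤ 1) (hb0 : ∀ k, 0 ≤ b k)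
    (hb : ∀ k, b k ≤ 1 - a k ^ 2 / 8) :
    ∑' k, w k * b k ≤ 1 - (∑' k, w k * a k) ^ 2 / 8 := by
  set m := ∑' k, w k * a k with hm
  have hsa : Summable fun k => w k * a k :=
    Summable.of_nonneg_of_le (fun k => mul_nonneg (hw k) (ha0 k))
      (fun k => mul_le_of_le_one_right (hw k) (ha1 k)) hs
  have hsb : Summable fun k => w k * b k :=
    Summable.of_nonneg_of_le (fun k => mul_nonneg (hw k) (hb0 k))
      (fun k => mul_le_of_le_one_right (hw k) ((hb k).trans (by nlinarith [sq_nonneg (a k)]))) hs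
  have hlin : HasSum (fun k => w k * (1 + m ^ 2 / 8) - w k * a k * (m / 4))
      (1 * (1 + m ^ 2 / 8) - m * (m / 4)) :=
    ((hw1 ▸ hs.hasSum).mul_right _).sub ((hm ▸ hsa.hasSum).mul_right _)
  suffices h : ∀ k, w k * b k ≤ w k * (1 + m ^ 2 / 8) - w k * a k * (m / 4) by
    have := hasSum_le h hsb.hasSum hlin
    linarith
  intro k
  nlinarith [mul_le_mul_of_nonneg_left (hb k) (hw k),
      mul_nonneg (hw k) (sq_nonneg (a k - m))]

end Mixtures

/-- A lower bound on the expectation of a test that holds for each ordering holds for the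
symmetrized law. -/
lemma le_sum_mul_symmetrize {β : Type*} [Fintype β] {s : ℕ} (g : β → ℝ)
    (Q : Equiv.Perm (Fin s) → β → ℝ) {v : ℝ} (h : ∀ σ, v ≤ ∑ y, g y * Q σ y) :
    v ≤ ∑ y, g y * ((∑ σ, Q σ y) / (Nat.factorial s)) := by
  have hf : (0 : ℝ) < Nat.factorial s := by exact_mod_cast Nat.factorial_pos s
  have : ∑ y, g y * ((∑ σ, Q σ y) / (Nat.factorial s))
      = (∑ σ, ∑ y, g y * Q σ y) / (Nat.factorial s) := by
    rw [Finset.sum_comm, Finset.sum_div]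
    refine Finset.sum_congr rfl fun y _ => ?_
    rw [← Finset.mul_sum, mul_div_assoc]
  rw [this, le_div_iff₀ hf]
  have h2 := Finset.card_nsmul_le_sum univ (fun σ => ∑ y, g y * Q σ y) v fun σ _ => h σ
  rw [Finset.card_univ, Fintype.card_perm, Fintype.card_fin, nsmul_eq_mul] at h2
  linarith

/-- A symmetrized product law whose factors have total mass close to one, put mass at least `d`
on a set `B` of size `s`, and rarely collide pairwise in `B`, is `ℓ₁`-far from every countable
mixture of product distributions. -/
lemma mixture_far_of_rare_collisions {n s : ℕ} {d ε : ℝ} (hs : 2 ≤ s) (hd : 0 < d) (hd1 : d ≤ 1)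
    (hε : ε * s ≤ d ^ 2 / 64) (hε0 : 0 ≤ ε)
    (B : Finset (Fin n)) (hB : #B = s) (q : Fin s → Fin n → ℝ)
    (hmass : ∀ i, 1 - ε ≤ ∑ x, q i x) (hmassB : ∀ i, d ≤ ∑ x ∈ B, q i x)
    (hcol : ∀ i j, i ≠ j →
      1 - ε ≤ (∑ x, q i x) * (∑ x, q j x) - ∑ x ∈ B, q i x * q j x)
    (p : ℕ → Fin n → ℝ) (w : ℕ → ℝ) (hp : ∀ k, IsDist (p k)) (hw : ∀ k, 0 ≤ w k)
    (hw1 : ∑' k, w k = 1) :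
    d ^ 2 / 64 ≤ ∑ y : Fin s → Fin n,
      |(∑ σ : Equiv.Perm (Fin s), ∏ i, q (σ i) (y i)) / (Nat.factorial s)
        - ∑' k, w k * ∏ i, p k (y i)| := by
  set D := ∑ y : Fin s → Fin n,
      |(∑ σ : Equiv.Perm (Fin s), ∏ i, q (σ i) (y i)) / (Nat.factorial s)
        - ∑' k, w k * ∏ i, p k (y i)| with hD
  have hws : Summable w := by
    by_contra h
    rw [tsum_eq_zero_of_not_summable h] at hw1
    norm_num at hw1
  have hp_le : ∀ k x, p k x ≤ 1 := fun k x =>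
    (hp k).2 ▸ Finset.single_le_sum (fun y _ => (hp k).1 y) (Finset.mem_univ x)
  have hR0 : ∀ k (y : Fin s → Fin n), 0 ≤ ∏ i, p k (y i) := fun k y =>
    Finset.prod_nonneg fun i _ => (hp k).1 _
  have hR1 : ∀ k (y : Fin s → Fin n), ∏ i, p k (y i) ≤ 1 := fun k y =>
    Finset.prod_le_one (fun i _ => (hp k).1 _) fun i _ => hp_le k _
  have hs0 : (2 : ℝ) ≤ s := by exact_mod_cast hs
  have hε1 : ε ≤ 1 / 64 := by nlinarith
  have hbern : ∀ r : ℕ, r ≤ s → 1 - d ^ 2 / 64 ≤ (1 - ε) ^ r := by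
    intro r hr
    have h1 := one_add_mul_le_pow (a := -ε) (by linarith) r
    have h2 : (r : ℝ) ≤ s := by exact_mod_cast hr
    have h3 : (1 - ε) ^ r = (1 + -ε) ^ r := by ring
    nlinarith
  let a : ℕ → ℝ := fun k => ∑ x ∈ B, p k x
  have ha0 : ∀ k, 0 ≤ a k := fun k => Finset.sum_nonneg fun x _ => (hp k).1 x
  have ha1 : ∀ k, a k ≤ 1 := fun k => (hp k).2 ▸ Finset.sum_le_univ_sum_of_nonneg (hp k).1
  -- the mean weight of `B`
  have hmean : d * (1 - d ^ 2 / 64) - D ≤ ∑' k, w k * a k := by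
    let i₀ : Fin s := ⟨0, by omega⟩
    let h : Fin n → ℝ := fun x => if x ∈ B then 1 else 0
    have hB' : ∀ r : Fin n → ℝ, ∑ x, h x * r x = ∑ x ∈ B, r x := fun r => by simp [h]
    have htest := abs_sum_mul_sub_le
      (fun y : Fin s → Fin n => (∑ σ : Equiv.Perm (Fin s), ∏ i, q (σ i) (y i)) / (Nat.factorial s))
      (fun y => ∑' k, w k * ∏ i, p k (y i)) (fun y => h (y i₀))
      (fun y => by simp only [h]; split_ifs <;> norm_num)
      (fun y => by simp only [h]; split_ifs <;> norm_num)
    rw [sum_mul_tsum_mixture w hw hws _ (fun k (y : Fin s → Fin n) => ∏ i, p k (y i)) hR0 hR1]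
      at htest
    have hM : ∀ k, ∑ y : Fin s → Fin n, h (y i₀) * ∏ i, p k (y i) = a k := fun k => by
      rw [sum_coord_mul_prod (fun _ => p k) h i₀, hB']
      simp [(hp k).2, a]
    simp_rw [hM] at htest
    have hP := le_sum_mul_symmetrize (fun y : Fin s → Fin n => h (y i₀))
      (fun σ y => ∏ i, q (σ i) (y i)) (v := d * (1 - d ^ 2 / 64)) fun σ => by
        rw [sum_coord_mul_prod (fun i => q (σ i)) h i₀, hB']
        have h1 : 1 - d ^ 2 / 64 ≤ ∏ i ∈ univ.erase i₀, ∑ x, q (σ i) x := by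
          refine (hbern (s - 1) (by omega)).trans ?_
          have : #(univ.erase i₀) = s - 1 := by simp
          rw [← this, ← Finset.prod_const]
          exact Finset.prod_le_prod (fun i _ => by linarith) fun i _ => hmass _
        have h2 : 0 ≤ 1 - d ^ 2 / 64 := by nlinarith
        exact mul_le_mul (hmassB _) h1 h2 (hd.le.trans (hmassB _))
    have := (abs_le.mp htest).2
    linarith
  -- the absence of collisions
  have hcoll : 1 - d ^ 2 / 64 - D ≤ 1 - (∑' k, w k * a k) ^ 2 / 8 := by
    let e : (Fin (s / 2) ⊕ Fin (s / 2)) ⊕ Fin (s % 2) ≃ Fin s :=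
      Fintype.equivOfCardEq (by simp; omega)
    let φ : (Fin s → Fin n) → ℝ := fun y =>
      ∏ j, noCollision B (y (e (.inl (.inl j)))) (y (e (.inl (.inr j))))
    have hφ0 : ∀ y, 0 ≤ φ y := fun y => Finset.prod_nonneg fun j _ => noCollision_nonneg _ _ _
    have hφ1 : ∀ y, φ y ≤ 1 := fun y =>
      Finset.prod_le_one (fun j _ => noCollision_nonneg _ _ _) fun j _ => noCollision_le_one _ _ _
    have htest := abs_sum_mul_sub_le
      (fun y : Fin s → Fin n => (∑ σ : Equiv.Perm (Fin s), ∏ i, q (σ i) (y i)) / (Nat.factorial s))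
      (fun y => ∑' k, w k * ∏ i, p k (y i)) φ hφ0 hφ1
    rw [sum_mul_tsum_mixture w hw hws _ (fun k (y : Fin s → Fin n) => ∏ i, p k (y i)) hR0 hR1]
      at htest
    have hM := tsum_mul_le_one_sub_sq w a (fun k => ∑ y, φ y * ∏ i, p k (y i)) hw hw1 hws ha0 ha1
      (fun k => Finset.sum_nonneg fun y _ => mul_nonneg (hφ0 y) (hR0 k y)) fun k => by
        simp only [φ]
        rw [sum_pairs_mul_prod e (fun _ => p k) (noCollision B)]
        simp only [sum_noCollision, (hp k).2, Finset.prod_const, Finset.card_univ,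
          Fintype.card_fin, one_pow, mul_one]
        exact pow_noCollision_le (hp k).1 (hp k).2 B (by omega)
    have hP := le_sum_mul_symmetrize φ
      (fun σ y => ∏ i, q (σ i) (y i)) (v := 1 - d ^ 2 / 64) fun σ => by
        simp only [φ]
        rw [sum_pairs_mul_prod e (fun i => q (σ i)) (noCollision B)]
        simp only [sum_noCollision]
        refine (hbern (s / 2 + s % 2) (by omega)).trans ?_
        rw [pow_add]
        have h1 : (1 - ε) ^ (s / 2) = ∏ _j : Fin (s / 2), (1 - ε) := by simp
        have h2 : (1 - ε) ^ (s % 2) = ∏ _j : Fin (s % 2), (1 - ε) := by simp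
        have h3 : (0 : ℝ) ≤ 1 - ε := by linarith
        have h4 : (1 - ε) ^ (s / 2) ≤ ∏ j : Fin (s / 2),
            ((∑ x, q (σ (e (.inl (.inl j)))) x) * (∑ x, q (σ (e (.inl (.inr j)))) x)
              - ∑ x ∈ B, q (σ (e (.inl (.inl j)))) x * q (σ (e (.inl (.inr j)))) x) := by
          rw [h1]
          refine Finset.prod_le_prod (fun _ _ => h3) fun j _ => hcol _ _ ?_
          simp
        have h5 : (1 - ε) ^ (s % 2) ≤ ∏ k : Fin (s % 2), ∑ x, q (σ (e (.inr k))) x := by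
          rw [h2]
          exact Finset.prod_le_prod (fun _ _ => h3) fun k _ => hmass _
        exact mul_le_mul h4 h5 (pow_nonneg h3 _) ((pow_nonneg h3 _).trans h4)
    have := (abs_le.mp htest).2
    linarith
  by_contra! hlt
  have hm : 15 / 16 * d ≤ ∑' k, w k * a k := by nlinarith
  nlinarith

/-- The perturbed weights have total mass `1 - 1/n`. -/
lemma sum_perturbed {n s : ℕ} (hsn : s < n) (δ : ℝ) (i : Fin s) :
    ∑ x : Fin n, (if (x : ℕ) = 0 then 1 - δ / 20 - (s : ℝ) / n
        else if (x : ℕ) = (i : ℕ) + 1 then δ / 20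
        else if (x : ℕ) ≤ s then 1 / n
        else 0) = 1 - 1 / (n : ℝ) := by
  have hi := i.isLt
  rw [Fin.sum_univ_eq_sum_range (fun x => if x = 0 then 1 - δ / 20 - (s : ℝ) / n
        else if x = (i : ℕ) + 1 then δ / 20 else if x ≤ s then 1 / (n : ℝ) else 0)]
  have key : ∀ x ∈ range n, (if x = 0 then 1 - δ / 20 - (s : ℝ) / n
        else if x = (i : ℕ) + 1 then δ / 20 else if x ≤ s then 1 / (n : ℝ) else 0)
      = (if x = 0 then 1 - δ / 20 - (s : ℝ) / n - 1 / n else 0)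
        + (if x = (i : ℕ) + 1 then δ / 20 - 1 / n else 0)
        + (if x ∈ range (s + 1) then 1 / (n : ℝ) else 0) := by
    intro x _
    rcases Nat.eq_zero_or_pos x with h | h
    · subst h; simp
    · by_cases h2 : x = (i : ℕ) + 1
      · subst h2; simp [hi]
      · simp [h.ne', h2]
  rw [Finset.sum_congr rfl key, Finset.sum_add_distrib, Finset.sum_add_distrib,
    Finset.sum_ite_eq', Finset.sum_ite_eq', Finset.sum_ite_mem,
    Finset.inter_eq_right.mpr (Finset.range_subset_range.mpr hsn)]
  have h1 : 0 < n := by omega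
  have h2 : (i : ℕ) + 1 < n := by omega
  simp only [Finset.mem_range, h1, h2, if_true, Finset.sum_const, Finset.card_range, nsmul_eq_mul]
  push_cast
  ring

/-- `⌈√(C n)⌉` is eventually a small fraction of `n`. -/
lemma ceil_sqrt_le_mul {C η : ℝ} (hC : 1 ≤ C) (hη : 0 < η) {n : ℕ} (hn : 1 ≤ n)
    (hn' : 4 * C / η ^ 2 ≤ n) : (⌈Real.sqrt (C * n)⌉₊ : ℝ) ≤ η * n := by
  have h1 : (1 : ℝ) ≤ n := by exact_mod_cast hn
  have h2 : 1 ≤ Real.sqrt (C * n) := Real.one_le_sqrt.mpr (by nlinarith)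
  have h3 := (Nat.ceil_lt_add_one (Real.sqrt_nonneg (C * n))).le
  have h4 : Real.sqrt (C * n) ≤ η * n / 2 := by
    rw [Real.sqrt_le_left (by positivity)]
    rw [div_le_iff₀ (by positivity)] at hn'
    nlinarith
  linarith

/-- Theorem 1.1 (failure of de Finetti's theorem with a sublinear number of samples).
For every `C > 10` there are `c > 0` and `n₀` such that for all `n ≥ n₀`, with
`s = ⌈√(C·n)⌉` and `δ = 1/C`, the explicitly defined distributions `q₁, …, q_s` over
`[n]` (here `[n]` is encoded by `Fin n`, the element labelled `m` having `val = m − 1`,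
and `i : Fin s` encodes the label `i.val + 1`):
`q_i(1) = 1 − δ/20 − s/n`, `q_i(i+1) = δ/20`, `q_i(x) = 1/n` for
`x ∈ {2,…,s+1}∖{i+1}`, and `q_i(x) = 0` for `x > s+1`, satisfy:
(a) `‖q_i − U_n‖₁ ≥ 1/3` for every `i`;
(b) the structural condition with respect to the uniform distribution; and
(c) the law `P` of the exchangeable sequence obtained by drawing `Y_i ~ q_i`
independently and applying a uniformly random permutation — explicitly
`P(y) = (Σ_σ Π_i q_{σ(i)}(y_i)) / s!` — is at `ℓ₁`-distance at least `c` from every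
countable mixture `M = Σ_k w_k·p_k^{⊗s}` of product distributions. -/
theorem definetti_failure :
    ∀ C : ℝ, 10 < C →
    ∃ c : ℝ, 0 < c ∧ ∃ n₀ : ℕ, ∀ n : ℕ, n₀ ≤ n →
    ∀ s : ℕ, s = ⌈Real.sqrt (C * n)⌉₊ →
    ∀ δ : ℝ, δ = 1 / C →
    ∀ q : Fin s → Fin n → ℝ,
      (∀ (i : Fin s) (x : Fin n), q i x =
        if (x : ℕ) = 0 then 1 - δ / 20 - (s : ℝ) / n
        else if (x : ℕ) = (i : ℕ) + 1 then δ / 20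
        else if (x : ℕ) ≤ s then 1 / n
        else 0) →
      (∀ i, ∑ x, |q i x - 1 / n| ≥ 1 / 3) ∧
      (∃ A : Finset (Fin n), ∀ (i : Fin s),
        (∀ x ∈ A, 1 / (n : ℝ) ≤ q i x) ∧ (∀ x ∉ A, q i x ≤ 1 / (n : ℝ))) ∧
      (∀ (p : ℕ → Fin n → ℝ) (w : ℕ → ℝ),
        (∀ k, IsDist (p k)) → (∀ k, 0 ≤ w k) → (∑' k, w k) = 1 →
        c ≤ ∑ y : Fin s → Fin n,
          |(∑ σ : Equiv.Perm (Fin s), ∏ i, q (σ i) (y i)) / (Nat.factorial s)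
            - ∑' k, w k * ∏ i, p k (y i)|) := by
  intro C hC
  have hC0 : 0 < C := by linarith
  refine ⟨(1 / C / 20) ^ 2 / 64, by positivity, 1 + ⌈4 * C / ((1 / C / 20) ^ 2 / 256) ^ 2⌉₊, ?_⟩
  intro n hn s hs δ hδ q hq
  rw [← hδ] at hn ⊢
  have hδ0 : 0 < δ := by rw [hδ]; positivity
  have hδ1 : δ < 1 / 10 := by
    rw [hδ]; exact one_div_lt_one_div_of_lt (by norm_num) hC
  have hn1 : 1 ≤ n := by omega
  have hn0 : (1 : ℝ) ≤ n := by exact_mod_cast hn1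
  have hsη : (s : ℝ) ≤ (δ / 20) ^ 2 / 256 * n := by
    rw [hs]
    refine ceil_sqrt_le_mul (by linarith) (by positivity) hn1 ((Nat.le_ceil _).trans ?_)
    exact_mod_cast (show _ ≤ n by omega)
  have hs2 : 2 ≤ s := by
    rw [hs]
    refine Nat.lt_ceil.mpr (Real.lt_sqrt_of_sq_lt ?_)
    push_cast
    nlinarith
  have hs2' : (2 : ℝ) ≤ s := by exact_mod_cast hs2
  have hsn' : (s : ℝ) / n ≤ (δ / 20) ^ 2 / 256 := by
    rwa [div_le_iff₀ (by linarith)]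
  have hsq : (δ / 20) ^ 2 / 256 ≤ δ / 1000 := by nlinarith
  have hninv : 1 / (n : ℝ) ≤ (s : ℝ) / n := by gcongr; linarith
  have hninv0 : 0 < 1 / (n : ℝ) := by positivity
  have hsn : s < n := by
    have : (s : ℝ) < n := by nlinarith
    exact_mod_cast this
  have hq0 : ∀ i x, 0 ≤ q i x := by
    intro i x
    rw [hq]
    split_ifs <;> linarith
  have hmass : ∀ i, ∑ x, q i x = 1 - 1 / (n : ℝ) := by
    intro i
    rw [← sum_perturbed hsn δ i]
    exact Finset.sum_congr rfl fun x _ => hq i x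
  refine ⟨fun i => ?_, ⟨univ.filter fun x => (x : ℕ) ≤ s, fun i => ⟨fun x hx => ?_, fun x hx => ?_⟩⟩,
    fun p w hp hw hw1 => ?_⟩
  · have h := Finset.single_le_sum (f := fun x => |q i x - 1 / n|) (fun x _ => abs_nonneg _)
      (Finset.mem_univ (⟨0, by omega⟩ : Fin n))
    refine le_trans ?_ h
    refine le_trans ?_ (le_abs_self _)
    rw [hq, if_pos rfl]
    linarith
  · have hx' : (x : ℕ) ≤ s := by simpa using hx
    rw [hq, if_pos hx']
    split_ifs <;> linarith
  · have hx' : ¬ (x : ℕ) ≤ s := by simpa using hx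
    have hi := i.isLt
    rw [hq, if_neg (by omega), if_neg (by omega), if_neg hx']
    exact hninv0.le
  · let B : Finset (Fin n) := univ.filter fun x => 1 ≤ (x : ℕ) ∧ (x : ℕ) ≤ s
    have hB : #B = s := by
      have : B = Finset.Icc (⟨1, by omega⟩ : Fin n) ⟨s, hsn⟩ := by
        ext x
        simp [B, Fin.le_def]
      rw [this]
      simp
    refine mixture_far_of_rare_collisions (d := δ / 20) (ε := 4 * (1 / n)) hs2 (by positivity)
      (by linarith) ?_ (by positivity) B hB q (fun i => ?_) (fun i => ?_) (fun i j hij => ?_)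
      p w hp hw hw1
    · have : 4 * (1 / (n : ℝ)) * s = 4 * (s / n) := by ring
      linarith
    · rw [hmass]; linarith
    · have hi := i.isLt
      have h := Finset.single_le_sum (f := q i) (s := B) (fun x _ => hq0 i x)
        (a := ⟨(i : ℕ) + 1, by omega⟩) (by simp [B])
      refine le_trans ?_ h
      rw [hq]
      simp
    · have hpt : ∀ x ∈ B, q i x * q j x ≤ 1 / n * (q i x + q j x) := by
        intro x hx
        have hx1 : 1 ≤ (x : ℕ) := (Finset.mem_filter.mp hx).2.1
        have hij' : (i : ℕ) ≠ j := fun h => hij (Fin.ext h)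
        have hor : q i x ≤ 1 / n ∨ q j x ≤ 1 / n := by
          by_cases h : (x : ℕ) = (i : ℕ) + 1
          · right
            rw [hq, if_neg (by omega), if_neg (by omega)]
            split_ifs <;> linarith
          · left
            rw [hq, if_neg (by omega), if_neg h]
            split_ifs <;> linarith
        rcases hor with h | h
        · nlinarith [hq0 i x, hq0 j x]
        · nlinarith [hq0 i x, hq0 j x]
      have hle : ∑ x ∈ B, q i x * q j x ≤ 1 / n * (∑ x, q i x + ∑ x, q j x) := by
        refine (Finset.sum_le_sum hpt).trans ?_
        rw [← Finset.mul_sum, ← Finset.sum_add_distrib]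
        refine mul_le_mul_of_nonneg_left ?_ hninv0.le
        exact Finset.sum_le_univ_sum_of_nonneg fun x => add_nonneg (hq0 i x) (hq0 j x)
      rw [hmass, hmass] at hle ⊢
      nlinarith
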